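/- Let q be a prime power, m, n, T positive integers, k_1, …, k_{T+1} positive integers with k_1 + ⋯ + k_{T+1} = mn, let S = (S_1, …, S_{T+1}) be a random variable with S_i ∈ F_q^{k_i}, let L be uniformly distributed on the set of all bijective F_q-linear maps on F_q^{mn} independent of S, fix 0 < ρ ≤ 1 and C1 > 1. Then with probability at least 1 − 2(2^T − 1) · n · q^{(n+1)²/4} / C1 over the choice of L, the realization ℓ satisfies, simultaneously for every 1 ≤ μ ≤ n, every (mμ) × (mn) eavesdropping matrix B of the form B_{μ×n} ⊗ I_m with rank(B_{μ×n}) = μ, and every nonempty 𝒾 ⊆ {1,…,T}: I(S_𝒾 ; B L S^t | L = ℓ) ≤ C1 · q^{mρμ} · E[ P_{S_{𝒾̄}|S_𝒾}(S_{𝒾̄}|S_𝒾)^ρ ] / ρ. -/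

import Mathlib

open scoped Classical
open Finset

noncomputable section

variable {Ω : Type*} [Fintype Ω]

/-- The probability P(X = x) of a random variable `X` on the finite
probability space `Ω` with probability mass function `p`. -/
def mprob {𝒳 : Type*} (p : Ω → ℝ) (X : Ω → 𝒳) (x : 𝒳) : ℝ :=
  ∑ ω, if X ω = x then p ω else 0

/-- The joint probability P(X = x, Y = y). -/
def jprob {𝒳 𝒴 : Type*} (p : Ω → ℝ) (X : Ω → 𝒳) (Y : Ω → 𝒴) (x : 𝒳) (y : 𝒴) : ℝ :=
  ∑ ω, if X ω = x ∧ Y ω = y then p ω else 0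

/-- The conditional probability P(X = x | Y = y). -/
def cprob {𝒳 𝒴 : Type*} (p : Ω → ℝ) (X : Ω → 𝒳) (Y : Ω → 𝒴) (x : 𝒳) (y : 𝒴) : ℝ :=
  jprob p X Y x y / mprob p Y y

/-- The conditional probability mass function of `p` given the event `Y = y`. -/
def condDist {𝒴 : Type*} (p : Ω → ℝ) (Y : Ω → 𝒴) (y : 𝒴) : Ω → ℝ :=
  fun ω => if Y ω = y then p ω / mprob p Y y else 0

/-- The probability of an event `E`. -/
def prEvent (p : Ω → ℝ) (E : Ω → Prop) : ℝ :=
  ∑ ω, if E ω then p ω else 0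

/-- Shannon entropy H(X) in nats. -/
def entropy {𝒳 : Type*} [Fintype 𝒳] (p : Ω → ℝ) (X : Ω → 𝒳) : ℝ :=
  -∑ x, mprob p X x * Real.log (mprob p X x)

/-- Conditional Shannon entropy H(X|Y) in nats. -/
def condEntropy {𝒳 𝒴 : Type*} [Fintype 𝒳] [Fintype 𝒴] (p : Ω → ℝ) (X : Ω → 𝒳) (Y : Ω → 𝒴) : ℝ :=
  -∑ x, ∑ y, jprob p X Y x y * Real.log (cprob p X Y x y)

/-- Shannon mutual information I(X;Y) in nats. -/
def mutInfo {𝒳 𝒴 : Type*} [Fintype 𝒳] [Fintype 𝒴] (p : Ω → ℝ) (X : Ω → 𝒳) (Y : Ω → 𝒴) : ℝ :=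
  ∑ x, ∑ y, jprob p X Y x y * Real.log (jprob p X Y x y / (mprob p X x * mprob p Y y))

/-- The expectation E[ P_{X|Y}(X|Y)^ρ ]. -/
def expPow {𝒳 𝒴 : Type*} (p : Ω → ℝ) (X : Ω → 𝒳) (Y : Ω → 𝒴) (ρ : ℝ) : ℝ :=
  ∑ ω, p ω * (cprob p X Y (X ω) (Y ω)) ^ ρ

end

/-- Concatenation of the messages `s = (s_1, …, s_{T+1})`, with `s_i ∈ F^{k_i}` and
`∑ k_i = mn`, into a single vector indexed by `Fin n × Fin m` (the `j`-th symbol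
of the `i`-th packet). -/
noncomputable def concat2 {T m n : ℕ} {F : Type*} (k : Fin (T + 1) → ℕ)
    (h : ∑ i, k i = m * n) (s : ∀ i, Fin (k i) → F) : Fin n × Fin m → F :=
  fun j =>
    let x := (Fintype.equivOfCardEq
      (by simp [h, Nat.mul_comm] :
        Fintype.card (Σ i : Fin (T + 1), Fin (k i)) = Fintype.card (Fin n × Fin m))).symm j
    s x.1 x.2


section Information

variable {α β 𝒳 𝒴 𝒵 𝒲 : Type*} [Fintype α] [Fintype β]

theorem mprob_nonneg {p : α → ℝ} (hp : ∀ a, 0 ≤ p a) (X : α → 𝒳) (x : 𝒳) :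
    0 ≤ mprob p X x :=
  sum_nonneg fun a _ => by split_ifs <;> simp [hp]

theorem le_mprob {p : α → ℝ} (hp : ∀ a, 0 ≤ p a) (X : α → 𝒳) (a : α) :
    p a ≤ mprob p X (X a) := by
  refine le_trans (by simp) (single_le_sum
    (f := fun b => if X b = X a then p b else 0) (fun b _ => ?_) (mem_univ a))
  split_ifs <;> simp [hp]

theorem jprob_eq_mprob_prod (p : α → ℝ) (X : α → 𝒳) (Y : α → 𝒴) (x : 𝒳) (y : 𝒴) :
    jprob p X Y x y = mprob p (fun a => (X a, Y a)) (x, y) := by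
  simp [jprob, mprob]

theorem sum_mprob_mul [Fintype 𝒳] (p : α → ℝ) (X : α → 𝒳) (f : 𝒳 → ℝ) :
    ∑ x, mprob p X x * f x = ∑ a, p a * f (X a) := by
  simp only [mprob, sum_mul, ite_mul, zero_mul]
  rw [sum_comm]
  simp

theorem sum_jprob_mul [Fintype 𝒳] [Fintype 𝒴] (p : α → ℝ) (X : α → 𝒳) (Y : α → 𝒴)
    (f : 𝒳 → 𝒴 → ℝ) :
    ∑ x, ∑ y, jprob p X Y x y * f x y = ∑ a, p a * f (X a) (Y a) := by
  simp only [jprob_eq_mprob_prod]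
  rw [← Fintype.sum_prod_type' (fun x y => mprob p (fun a => (X a, Y a)) (x, y) * f x y)]
  exact sum_mprob_mul p (fun a => (X a, Y a)) fun z => f z.1 z.2

theorem sum_mprob [Fintype 𝒳] (p : α → ℝ) (X : α → 𝒳) :
    ∑ x, mprob p X x = ∑ a, p a := by
  simpa using sum_mprob_mul p X fun _ => 1

theorem mprob_map [Fintype 𝒳] (p : α → ℝ) (X : α → 𝒳) (Y : 𝒳 → 𝒴) (y : 𝒴) :
    mprob (mprob p X) Y y = mprob p (fun a => Y (X a)) y := by
  simpa [mprob] using sum_mprob_mul p X fun x => if Y x = y then 1 else 0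

theorem expPow_map [Fintype 𝒳] (p : α → ℝ) (X : α → 𝒳) (Y : 𝒳 → 𝒴) (Z : 𝒳 → 𝒵) (ρ : ℝ) :
    expPow (mprob p X) Y Z ρ = expPow p (fun a => Y (X a)) (fun a => Z (X a)) ρ := by
  simp only [expPow, cprob, jprob_eq_mprob_prod, mprob_map]
  exact sum_mprob_mul p X _

/-- Conditioning on `L = ℓ` leaves the law of an independent variable `S` unchanged. -/
theorem mprob_condDist [Fintype 𝒳] {p : α → ℝ} {S : α → 𝒳} {L : α → 𝒲} {ℓ : 𝒲}
    (hL : mprob p L ℓ ≠ 0) (hLS : ∀ s, jprob p S L s ℓ = mprob p S s * mprob p L ℓ)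
    (Y : 𝒲 → 𝒳 → 𝒴) (y : 𝒴) :
    mprob (condDist p L ℓ) (fun a => Y (L a) (S a)) y = mprob (mprob p S) (Y ℓ) y := by
  have key (s : 𝒳) : mprob p S s = ∑ a, if S a = s ∧ L a = ℓ then p a / mprob p L ℓ else 0 := by
    rw [eq_comm, ← mul_div_cancel_right₀ (mprob p S s) hL, ← hLS s, jprob, sum_div]
    exact sum_congr rfl fun a _ => by split_ifs <;> simp
  rw [mprob, mprob]
  simp_rw [key, ← sum_filter (fun s => Y ℓ s = y)]
  rw [sum_comm]
  refine sum_congr rfl fun a _ => ?_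
  by_cases h : L a = ℓ <;> simp [condDist, h]

theorem mutInfo_condDist [Fintype 𝒳] [Fintype 𝒴] [Fintype 𝒵] {p : α → ℝ} {S : α → 𝒳}
    {L : α → 𝒲} {ℓ : 𝒲} (hL : mprob p L ℓ ≠ 0)
    (hLS : ∀ s, jprob p S L s ℓ = mprob p S s * mprob p L ℓ)
    (Y : 𝒳 → 𝒴) (Z : 𝒲 → 𝒳 → 𝒵) :
    mutInfo (condDist p L ℓ) (fun a => Y (S a)) (fun a => Z (L a) (S a)) =
      mutInfo (mprob p S) Y (Z ℓ) := by
  simp only [mutInfo, jprob_eq_mprob_prod]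
  have h1 := mprob_condDist hL hLS (fun _ s => Y s)
  have h2 := mprob_condDist hL hLS Z
  have h3 := mprob_condDist hL hLS (fun l s => (Y s, Z l s))
  simp only [h1, h2, h3]

theorem mutInfo_eq_sum [Fintype 𝒳] [Fintype 𝒴] (p : α → ℝ) (X : α → 𝒳) (Y : α → 𝒴) :
    mutInfo p X Y = ∑ a, p a * Real.log (jprob p X Y (X a) (Y a) /
      (mprob p X (X a) * mprob p Y (Y a))) :=
  sum_jprob_mul p X Y _

/-- Mutual information does not change when one of the variables is relabelled injectively. -/
theorem mutInfo_comp_injective [Fintype 𝒳] [Fintype 𝒴] [Fintype 𝒵] (p : α → ℝ) (X : α → 𝒳)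
    (Y : α → 𝒴) {e : 𝒴 → 𝒵} (he : Function.Injective e) :
    mutInfo p X (fun a => e (Y a)) = mutInfo p X Y := by
  simp only [mutInfo_eq_sum, jprob, mprob, he.eq_iff]

theorem mutInfo_nonneg [Fintype 𝒳] [Fintype 𝒴] {p : α → ℝ} (hp : ∀ a, 0 ≤ p a)
    (hp1 : ∑ a, p a = 1) (X : α → 𝒳) (Y : α → 𝒴) : 0 ≤ mutInfo p X Y := by
  have h (x : 𝒳) (y : 𝒴) : jprob p X Y x y - mprob p X x * mprob p Y y ≤
      jprob p X Y x y * Real.log (jprob p X Y x y / (mprob p X x * mprob p Y y)) := by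
    have hj : 0 ≤ jprob p X Y x y := jprob_eq_mprob_prod p X Y x y ▸ mprob_nonneg hp _ _
    rcases hj.eq_or_lt with hj | hj
    · simpa [← hj] using mul_nonneg (mprob_nonneg hp X x) (mprob_nonneg hp Y y)
    have hx : 0 < mprob p X x := hj.trans_le <| sum_le_sum fun a _ => by
      have := hp a
      split_ifs <;> simp_all
    have hy : 0 < mprob p Y y := hj.trans_le <| sum_le_sum fun a _ => by
      have := hp a
      split_ifs <;> simp_all
    have := mul_le_mul_of_nonneg_left (Real.one_sub_inv_le_log_of_pos
      (div_pos hj (mul_pos hx hy))) hj.le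
    refine le_trans (le_of_eq ?_) this
    field_simp
  calc (0 : ℝ) = ∑ x, ∑ y, (jprob p X Y x y - mprob p X x * mprob p Y y) := by
        have := sum_jprob_mul p X Y fun _ _ => 1
        simp only [mul_one, hp1] at this
        simp [sum_sub_distrib, this, ← mul_sum, sum_mprob, hp1]
    _ ≤ mutInfo p X Y := sum_le_sum fun x _ => sum_le_sum fun y _ => h x y

/-- Replacing the law of `Y` by the uniform law can only increase mutual information. -/
theorem mutInfo_le_sum_log [Fintype 𝒳] [Fintype 𝒴] [Nonempty 𝒴] {p : α → ℝ}
    (hp : ∀ a, 0 ≤ p a) (hp1 : ∑ a, p a = 1) (X : α → 𝒳) (Y : α → 𝒴) :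
    mutInfo p X Y ≤ ∑ a, p a * Real.log (Fintype.card 𝒴 * jprob p X Y (X a) (Y a) /
      mprob p X (X a)) := by
  have hc : (0 : ℝ) < Fintype.card 𝒴 := by exact_mod_cast Fintype.card_pos
  have hY : 0 ≤ ∑ a, p a * Real.log (Fintype.card 𝒴 * mprob p Y (Y a)) := by
    rw [← sum_mprob_mul p Y fun y => Real.log (Fintype.card 𝒴 * mprob p Y y)]
    calc (0 : ℝ) = ∑ y, (mprob p Y y - 1 / Fintype.card 𝒴) := by
          simp [sum_sub_distrib, sum_mprob, hp1, hc.ne']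
      _ ≤ _ := sum_le_sum fun y _ => by
          rcases (mprob_nonneg hp Y y).eq_or_lt with h | h
          · simp [← h]
          have := mul_le_mul_of_nonneg_left (Real.one_sub_inv_le_log_of_pos (mul_pos hc h)) h.le
          refine le_trans (le_of_eq ?_) this
          field_simp
  rw [mutInfo_eq_sum]
  refine (le_add_of_nonneg_right hY).trans_eq ?_
  rw [← sum_add_distrib]
  refine sum_congr rfl fun a _ => ?_
  rcases (hp a).eq_or_lt with h | h
  · simp [← h]
  have hx := h.trans_le (le_mprob hp X a)
  have hy := h.trans_le (le_mprob hp Y a)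
  have hj : 0 < jprob p X Y (X a) (Y a) := by
    rw [jprob_eq_mprob_prod]
    exact h.trans_le (le_mprob hp (fun a => (X a, Y a)) a)
  rw [← mul_add, ← Real.log_mul (by positivity) (by positivity)]
  congr 2
  field_simp

theorem log_one_add_le_rpow_div {x ρ : ℝ} (hx : 0 ≤ x) (hρ0 : 0 < ρ) (hρ1 : ρ ≤ 1) :
    Real.log (1 + x) ≤ x ^ ρ / ρ := by
  rw [le_div_iff₀ hρ0, mul_comm, ← Real.log_rpow (by positivity)]
  have h := Real.rpow_add_le_add_rpow zero_le_one hx hρ0.le hρ1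
  rw [Real.one_rpow] at h
  have := Real.log_le_sub_one_of_pos (x := (1 + x) ^ ρ) (by positivity)
  linarith

/-- Privacy amplification: hashing with a random member of a two-universal family leaks, on
average, at most `|𝒴|^ρ E[P_{Z|X}(Z|X)^ρ] / ρ`. -/
theorem sum_mutInfo_le_of_twoUniversal [Fintype 𝒳] [Fintype 𝒴] [Nonempty 𝒴] {p : α → ℝ}
    (hp : ∀ a, 0 ≤ p a) (hp1 : ∑ a, p a = 1) (X : α → 𝒳) (Z : α → 𝒵)
    (h : β → α → 𝒴)
    (hh : ∀ a b, a ≠ b → #{g | h g b = h g a} * Fintype.card 𝒴 ≤ Fintype.card β)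
    {ρ : ℝ} (hρ0 : 0 < ρ) (hρ1 : ρ ≤ 1) :
    ∑ g, mutInfo p X (h g) ≤
      Fintype.card β * ((Fintype.card 𝒴 : ℝ) ^ ρ * expPow p Z X ρ / ρ) := by
  have hc : (0 : ℝ) < Fintype.card 𝒴 := by exact_mod_cast Fintype.card_pos
  set c := (Fintype.card 𝒴 : ℝ)
  have hjnn (a b) : 0 ≤ jprob p Z X a b := by
    rw [jprob_eq_mprob_prod]; exact mprob_nonneg hp _ _
  have collision (a : α) : ∑ g, c * jprob p X (h g) (X a) (h g a) ≤
      Fintype.card β * (c * p a + mprob p X (X a)) := by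
    have hb (b : α) : c * (#{g | h g b = h g a} : ℝ) ≤
        Fintype.card β * (c * (if b = a then 1 else 0) + 1) := by
      by_cases hab : b = a
      · subst hab
        simp only [filter_true, card_univ, if_true]
        have : (0 : ℝ) ≤ Fintype.card β := by positivity
        linarith
      · simp only [hab, if_false, mul_zero, zero_add, mul_one]
        rw [mul_comm]
        simpa using Nat.cast_le (α := ℝ).mpr (hh a b (Ne.symm hab))
    calc ∑ g, c * jprob p X (h g) (X a) (h g a)
        = ∑ b, (if X b = X a then p b else 0) * (c * (#{g | h g b = h g a} : ℝ)) := by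
          simp only [jprob, mul_sum, card_filter, Nat.cast_sum]
          rw [sum_comm]
          refine sum_congr rfl fun b _ => sum_congr rfl fun g _ => ?_
          by_cases h1 : X b = X a <;> by_cases h2 : h g b = h g a <;> simp [h1, h2, mul_comm]
      _ ≤ ∑ b, (if X b = X a then p b else 0) *
            (Fintype.card β * (c * (if b = a then 1 else 0) + 1)) :=
          sum_le_sum fun b _ => mul_le_mul_of_nonneg_left (hb b) (by split_ifs <;> simp [hp])
      _ = _ := by
          simp only [mprob, mul_add, mul_one, sum_add_distrib, mul_sum, mul_ite, mul_zero]
          simp only [sum_ite_eq', mem_univ, if_true]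
          congr 1
          · ring
          · exact sum_congr rfl fun b _ => by split_ifs <;> ring
  calc ∑ g, mutInfo p X (h g)
      ≤ ∑ g, ∑ a, p a * Real.log (c * jprob p X (h g) (X a) (h g a) / mprob p X (X a)) :=
        sum_le_sum fun g _ => mutInfo_le_sum_log hp hp1 X (h g)
    _ = ∑ a, p a * ∑ g, Real.log (c * jprob p X (h g) (X a) (h g a) / mprob p X (X a)) := by
        rw [sum_comm]; simp only [mul_sum]
    _ ≤ ∑ a, p a * (Fintype.card β * (c ^ ρ * cprob p Z X (Z a) (X a) ^ ρ / ρ)) := by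
        refine sum_le_sum fun a _ => ?_
        rcases (hp a).eq_or_lt with h0 | h0
        · simp [← h0]
        refine mul_le_mul_of_nonneg_left ?_ h0.le
        have hx := h0.trans_le (le_mprob hp X a)
        have hq : p a / mprob p X (X a) ≤ cprob p Z X (Z a) (X a) := by
          refine div_le_div_of_nonneg_right ?_ hx.le
          rw [jprob_eq_mprob_prod]
          exact le_mprob hp (fun a => (Z a, X a)) a
        set r := cprob p Z X (Z a) (X a)
        have hr : 0 < r := (div_pos h0 hx).trans_le hq
        have hA : 0 < 1 + c * r := by positivity
        have tangent (g : β) :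
            Real.log (c * jprob p X (h g) (X a) (h g a) / mprob p X (X a)) ≤
              Real.log (1 + c * r) +
                (c * jprob p X (h g) (X a) (h g a) / (mprob p X (X a) * (1 + c * r)) - 1) := by
          have hj : 0 < jprob p X (h g) (X a) (h g a) := by
            rw [jprob_eq_mprob_prod]
            exact h0.trans_le (le_mprob hp (fun a => (X a, h g a)) a)
          have := Real.log_le_sub_one_of_pos (x := c * jprob p X (h g) (X a) (h g a) /
            (mprob p X (X a) * (1 + c * r))) (by positivity)
          rw [← div_div, Real.log_div (by positivity) hA.ne', div_div] at this
          linarith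
        refine (sum_le_sum fun g _ => tangent g).trans ?_
        have hlog := log_one_add_le_rpow_div (mul_pos hc hr).le hρ0 hρ1
        rw [Real.mul_rpow hc.le hr.le] at hlog
        have hsum : ∑ g, c * jprob p X (h g) (X a) (h g a) / (mprob p X (X a) * (1 + c * r)) ≤
            Fintype.card β := by
          rw [← sum_div, div_le_iff₀ (by positivity)]
          refine (collision a).trans (mul_le_mul_of_nonneg_left ?_ (by positivity))
          rw [div_le_iff₀ hx] at hq
          nlinarith [mul_le_mul_of_nonneg_left hq hc.le]
        simp only [sum_add_distrib, sum_sub_distrib, sum_const, card_univ, nsmul_eq_mul, mul_one]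
        have := mul_le_mul_of_nonneg_left hlog (Nat.cast_nonneg (α := ℝ) (Fintype.card β))
        linarith
    _ = _ := by
        simp only [expPow, mul_sum, sum_div]
        exact sum_congr rfl fun a _ => by ring

theorem expPow_pos {p : α → ℝ} (hp : ∀ a, 0 ≤ p a) (hp1 : ∑ a, p a = 1) (X : α → 𝒳)
    (Y : α → 𝒴) (ρ : ℝ) : 0 < expPow p X Y ρ := by
  have hnn (a : α) : 0 ≤ p a * cprob p X Y (X a) (Y a) ^ ρ := by
    refine mul_nonneg (hp a) (Real.rpow_nonneg (div_nonneg ?_ (mprob_nonneg hp _ _)) _)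
    rw [jprob_eq_mprob_prod]
    exact mprob_nonneg hp _ _
  obtain ⟨a, -, ha⟩ : ∃ a ∈ univ, 0 < p a := exists_lt_of_sum_lt (by simp [hp1])
  refine (mul_pos ha (Real.rpow_pos_of_pos (div_pos ?_ ?_) ρ)).trans_le
    (single_le_sum (fun b _ => hnn b) (mem_univ a))
  · rw [jprob_eq_mprob_prod]
    exact ha.trans_le (le_mprob hp (fun a => (X a, Y a)) a)
  · exact ha.trans_le (le_mprob hp Y a)

end Information

section LinearAlgebra

variable {F ι κ : Type*} [Field F] [Fintype ι]

theorem mulVec_surjective_of_rank_eq [Fintype κ] {A : Matrix κ ι F}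
    (hA : A.rank = Fintype.card κ) : Function.Surjective A.mulVec := by
  have : LinearMap.range A.mulVecLin = ⊤ :=
    Submodule.eq_top_of_finrank_eq (by simpa [Matrix.rank] using hA)
  exact LinearMap.range_eq_top.mp this

theorem kronecker_one_mulVec_surjective {κ' : Type*} [Fintype κ] [DecidableEq κ] [Fintype κ']
    [DecidableEq κ'] {A : Matrix κ ι F} (hA : A.rank = Fintype.card κ) :
    Function.Surjective
      (Matrix.kroneckerMap (· * ·) A (1 : Matrix κ' κ' F)).mulVec := by
  obtain ⟨R, hR⟩ := Matrix.mulVec_surjective_iff_exists_right_inverse.mp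
    (mulVec_surjective_of_rank_eq hA)
  refine Matrix.mulVec_surjective_iff_exists_right_inverse.mpr
    ⟨Matrix.kroneckerMap (· * ·) R (1 : Matrix κ' κ' F), ?_⟩
  rw [← Matrix.mul_kronecker_mul, hR, mul_one]
  exact Matrix.one_kronecker_one

variable [DecidableEq ι]

theorem exists_GL_mulVec_eq {v w : ι → F} (hv : v ≠ 0) (hw : w ≠ 0) :
    ∃ g : GL ι F, (g : Matrix ι ι F).mulVec v = w := by
  obtain ⟨e, he⟩ := Submodule.exists_linearEquiv_restrict_eq
    ((LinearEquiv.toSpanNonzeroSingleton F _ v hv).symm ≪≫ₗ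
      LinearEquiv.toSpanNonzeroSingleton F _ w hw)
  refine ⟨Matrix.GeneralLinearGroup.toLin.symm
    (LinearMap.GeneralLinearGroup.ofLinearEquiv e), ?_⟩
  have h := he ⟨v, Submodule.mem_span_singleton_self v⟩
  rw [← LinearEquiv.toSpanNonzeroSingleton_one F _ v hv, LinearEquiv.trans_apply,
    LinearEquiv.symm_apply_apply] at h
  simp only [LinearEquiv.toSpanNonzeroSingleton_apply, one_smul] at h
  rw [h]
  have := Matrix.GeneralLinearGroup.toLin.apply_symm_apply
    (LinearMap.GeneralLinearGroup.ofLinearEquiv e)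
  exact congrArg (fun g : LinearMap.GeneralLinearGroup F (ι → F) =>
    (g : (ι → F) →ₗ[F] (ι → F)) v) this

variable [Fintype F]

/-- Each kernel of a full-rank `μ × n` matrix comes from `|GL_μ|` matrices, so this bounds the
cardinality of the Grassmannian. -/
theorem card_rank_eq_le {μ n : ℕ} (hμ : μ ≤ n) :
    #{A : Matrix (Fin μ) (Fin n) F | A.rank = μ} ≤
      Fintype.card F ^ (μ * (n - μ + 1)) * Nat.card (GL (Fin μ) F) := by
  have hq : 2 ≤ Fintype.card F := Fintype.one_lt_card
  have hcard : #{A : Matrix (Fin μ) (Fin n) F | A.rank = μ} =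
      ∏ i : Fin μ, (Fintype.card F ^ n - Fintype.card F ^ (i : ℕ)) := by
    have := card_linearIndependent (K := F) (V := Fin n → F) (k := μ) (by simpa using hμ)
    rw [Module.finrank_fin_fun] at this
    rw [← this, Nat.card_eq_fintype_card, Fintype.card_subtype]
    refine congrArg card (filter_congr fun A _ => ?_)
    rw [Matrix.rank_eq_finrank_span_row, eq_comm]
    change _ ↔ LinearIndependent F A.row
    simpa [Set.finrank] using
      (linearIndependent_iff_card_eq_finrank_span (R := F) (b := A.row)).symm
  rw [hcard, Matrix.card_GL_field, mul_comm μ, pow_mul, ← Fin.prod_const μ (Fintype.card F ^ (n - μ + 1)),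
    ← prod_mul_distrib]
  refine prod_le_prod' fun i _ => ?_
  rw [Nat.mul_sub, ← pow_add, ← pow_add, show n - μ + 1 + μ = n + 1 by omega, pow_succ]
  have h1 : Fintype.card F ^ (n - μ + 1 + i) ≤ Fintype.card F ^ n :=
    Nat.pow_le_pow_right (by omega) (by omega)
  have h2 := Nat.mul_le_mul_left (Fintype.card F ^ n) hq
  omega

variable [DecidableEq F]

/-- A surjective linear map composed with a uniformly random invertible one is two-universal. -/
theorem card_GL_mulVec_eq_zero_mul_le [Fintype κ] {A : Matrix κ ι F}
    (hA : Function.Surjective A.mulVec) {v : ι → F} (hv : v ≠ 0) :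
    #{g : GL ι F | A.mulVec ((g : Matrix ι ι F).mulVec v) = 0} * Fintype.card (κ → F) ≤
      Fintype.card (GL ι F) := by
  set N : (ι → F) → ℕ := fun w => #{g : GL ι F | A.mulVec ((g : Matrix ι ι F).mulVec w) = 0}
  have hN (w : ι → F) (hw : w ≠ 0) : N w = N v := by
    obtain ⟨t, rfl⟩ := exists_GL_mulVec_eq hv hw
    refine card_equiv (Equiv.mulRight t) fun g => ?_
    simp [Matrix.mulVec_mulVec]
  have hker (g : GL ι F) :
      #{w : ι → F | A.mulVec ((g : Matrix ι ι F).mulVec w) = 0} * Fintype.card (κ → F) =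
        Fintype.card (ι → F) := by
    have hs : Function.Surjective (A * (g : Matrix ι ι F)).mulVecLin := by
      intro z
      obtain ⟨x, hx⟩ := hA z
      refine ⟨((g⁻¹ : GL ι F) : Matrix ι ι F).mulVec x, ?_⟩
      simp [Matrix.mulVec_mulVec, hx]
    have hfib (z : κ → F) : #{w : ι → F | (A * (g : Matrix ι ι F)).mulVecLin w = z} =
        #{w : ι → F | (A * (g : Matrix ι ι F)).mulVecLin w = 0} :=
      AddMonoidHom.card_fiber_eq_of_mem_range (A * (g : Matrix ι ι F)).mulVecLin.toAddMonoidHom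
        (hs z) (hs 0)
    have := card_eq_sum_card_fiberwise (f := (A * (g : Matrix ι ι F)).mulVecLin)
      (s := univ) (t := univ) (fun _ _ => by simp)
    rw [sum_congr rfl fun z _ => hfib z, sum_const, smul_eq_mul, card_univ, card_univ] at this
    rw [this, mul_comm]
    simp [Matrix.mulVec_mulVec]
  have hcount : N v * (Fintype.card (ι → F) - 1) + Fintype.card (GL ι F) =
      ∑ g : GL ι F, #{w : ι → F | A.mulVec ((g : Matrix ι ι F).mulVec w) = 0} := by
    have : ∑ g : GL ι F, #{w : ι → F | A.mulVec ((g : Matrix ι ι F).mulVec w) = 0} =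
        ∑ w, N w := by
      simp only [N, card_filter]
      exact sum_comm
    rw [this, ← sum_erase_add univ N (mem_univ 0),
      sum_congr rfl fun w hw => hN w (ne_of_mem_erase hw), sum_const, card_erase_of_mem (mem_univ _),
      smul_eq_mul, card_univ, mul_comm]
    simp [N, card_univ]
  have htotal := congrArg (· * Fintype.card (κ → F)) hcount
  simp only [add_mul, sum_mul, hker, sum_const, card_univ, smul_eq_mul] at htotal
  have hV : 1 < Fintype.card (ι → F) := Fintype.one_lt_card_iff.mpr ⟨v, 0, hv⟩
  have hZ : 1 ≤ Fintype.card (κ → F) := Fintype.card_pos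
  generalize Fintype.card (ι → F) = a at *
  generalize Fintype.card (κ → F) = z at *
  generalize Fintype.card (GL ι F) = G at *
  change N v * z ≤ G
  obtain ⟨a, rfl⟩ := Nat.exists_eq_add_of_lt hV
  obtain ⟨z, rfl⟩ := Nat.exists_eq_add_of_le hZ
  rw [show 1 + a + 1 - 1 = a + 1 by omega] at htotal
  refine Nat.le_of_mul_le_mul_right (c := a + 1) ?_ (by omega)
  nlinarith [Nat.zero_le (G * z)]

end LinearAlgebra

section UnionBound

variable {F : Type*} [Field F] [Fintype F]

theorem rank_exponent_le {n μ : ℕ} (hμ : μ ≤ n) :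
    (Fintype.card F : ℝ) ^ (μ * (n - μ + 1)) ≤ (Fintype.card F : ℝ) ^ (((n : ℝ) + 1) ^ 2 / 4) := by
  rw [← Real.rpow_natCast]
  refine Real.rpow_le_rpow_of_exponent_le (by exact_mod_cast Fintype.card_pos) ?_
  push_cast [Nat.cast_sub hμ]
  nlinarith [sq_nonneg ((n : ℝ) + 1 - 2 * μ)]

variable [DecidableEq F]

/-- A nonnegative function on matrices that is invariant under row operations and at least `1` at
one full-rank matrix sums to at least `|GL_μ|`. -/
theorem card_GL_le_sum_of_one_le {μ n : ℕ} {f : Matrix (Fin μ) (Fin n) F → ℝ} (hf : ∀ A, 0 ≤ f A)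
    (hinv : ∀ (g : GL (Fin μ) F) A, f ((g : Matrix (Fin μ) (Fin μ) F) * A) = f A)
    {A : Matrix (Fin μ) (Fin n) F} (hA : A.rank = μ) (h1 : 1 ≤ f A) :
    (Nat.card (GL (Fin μ) F) : ℝ) ≤ ∑ B with B.rank = μ, f B := by
  obtain ⟨R, hR⟩ := Matrix.mulVec_surjective_iff_exists_right_inverse.mp
    (mulVec_surjective_of_rank_eq (A := A) (by simpa using hA))
  have hinj : Function.Injective fun g : GL (Fin μ) F => (g : Matrix (Fin μ) (Fin μ) F) * A := by
    intro g g' h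
    have := congrArg (· * R) h
    simp only [Matrix.mul_assoc, hR, mul_one] at this
    exact Units.ext this
  calc (Nat.card (GL (Fin μ) F) : ℝ) = ∑ _g : GL (Fin μ) F, (1 : ℝ) := by
        simp [Nat.card_eq_fintype_card]
    _ ≤ ∑ g : GL (Fin μ) F, f ((g : Matrix (Fin μ) (Fin μ) F) * A) :=
        sum_le_sum fun g _ => (hinv g A).symm ▸ h1
    _ = ∑ B ∈ univ.image fun g : GL (Fin μ) F => (g : Matrix (Fin μ) (Fin μ) F) * A, f B :=
        (sum_image fun _ _ _ _ h => hinj h).symm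
    _ ≤ _ := by
        refine sum_le_sum_of_subset_of_nonneg (fun B hB => ?_) fun B _ _ => hf B
        obtain ⟨g, -, rfl⟩ := mem_image.mp hB
        rw [mem_filter]
        exact ⟨mem_univ _, (Matrix.rank_mul_eq_right_of_isUnit_det _ _
          ((Matrix.isUnit_iff_isUnit_det _).mp g.isUnit)).trans hA⟩

/-- Markov's inequality and the union bound over all kernels of full-rank `μ × n` matrices,
`1 ≤ μ ≤ n`, and over a finite index set `s`. -/
theorem card_bad_le {β γ : Type*} [Fintype β] (n : ℕ) (s : Finset γ)
    (f : β → (μ : ℕ) → Matrix (Fin μ) (Fin n) F → γ → ℝ)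
    (hf : ∀ ℓ μ A i, 0 ≤ f ℓ μ A i)
    (hinv : ∀ ℓ μ i (g : GL (Fin μ) F) A,
      f ℓ μ ((g : Matrix (Fin μ) (Fin μ) F) * A) i = f ℓ μ A i)
    {δ : ℝ} (hδ : 0 ≤ δ)
    (hmean : ∀ μ (A : Matrix (Fin μ) (Fin n) F), A.rank = μ → ∀ i,
      ∑ ℓ, f ℓ μ A i ≤ Fintype.card β * δ)
    {E : β → Prop} [DecidablePred E]
    (hE : ∀ ℓ, ¬ E ℓ → ∃ μ, 1 ≤ μ ∧ μ ≤ n ∧ ∃ A : Matrix (Fin μ) (Fin n) F, A.rank = μ ∧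
      ∃ i ∈ s, 1 ≤ f ℓ μ A i) :
    (#{ℓ | ¬ E ℓ} : ℝ) ≤
      Fintype.card β * (n * #s * ((Fintype.card F : ℝ) ^ (((n : ℝ) + 1) ^ 2 / 4) * δ)) := by
  set Q := (Fintype.card F : ℝ) ^ (((n : ℝ) + 1) ^ 2 / 4)
  have hG (μ : ℕ) : (0 : ℝ) < Nat.card (GL (Fin μ) F) := by exact_mod_cast Nat.card_pos
  have hnn (ℓ μ i) : 0 ≤ (∑ A : Matrix (Fin μ) (Fin n) F with A.rank = μ, f ℓ μ A i) /
      Nat.card (GL (Fin μ) F) :=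
    div_nonneg (sum_nonneg fun A _ => hf ℓ μ A i) (hG μ).le
  calc (#{ℓ | ¬ E ℓ} : ℝ) = ∑ ℓ, if ¬ E ℓ then (1 : ℝ) else 0 := by
        rw [card_filter, Nat.cast_sum]
        exact sum_congr rfl fun ℓ _ => by split_ifs <;> simp
    _ ≤ ∑ ℓ, ∑ μ ∈ Icc 1 n, ∑ i ∈ s,
          (∑ A : Matrix (Fin μ) (Fin n) F with A.rank = μ, f ℓ μ A i) /
            Nat.card (GL (Fin μ) F) := by
        refine sum_le_sum fun ℓ _ => ?_
        split_ifs with h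
        · exact sum_nonneg fun μ _ => sum_nonneg fun i _ => hnn ℓ μ i
        · obtain ⟨μ, hμ1, hμn, A, hA, i, hi, h1⟩ := hE ℓ h
          refine le_trans ?_ (single_le_sum
            (fun μ _ => sum_nonneg fun i _ => hnn ℓ μ i) (mem_Icc.mpr ⟨hμ1, hμn⟩))
          refine le_trans ?_ (single_le_sum (fun i _ => hnn ℓ μ i) hi)
          rw [one_le_div (hG μ)]
          exact card_GL_le_sum_of_one_le (fun A => hf ℓ μ A i) (hinv ℓ μ i) hA h1
    _ = ∑ μ ∈ Icc 1 n, ∑ i ∈ s, (∑ A : Matrix (Fin μ) (Fin n) F with A.rank = μ,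
          ∑ ℓ, f ℓ μ A i) / Nat.card (GL (Fin μ) F) := by
        rw [sum_comm]
        refine sum_congr rfl fun μ _ => ?_
        rw [sum_comm]
        refine sum_congr rfl fun i _ => ?_
        rw [← sum_div, sum_comm]
    _ ≤ ∑ μ ∈ Icc 1 n, ∑ i ∈ s, Fintype.card β * (Q * δ) := by
        refine sum_le_sum fun μ hμ => sum_le_sum fun i _ => ?_
        have hμn := (mem_Icc.mp hμ).2
        rw [div_le_iff₀ (hG μ)]
        have hcount : (#{A : Matrix (Fin μ) (Fin n) F | A.rank = μ} : ℝ) ≤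
            Q * Nat.card (GL (Fin μ) F) := by
          have h : (#{A : Matrix (Fin μ) (Fin n) F | A.rank = μ} : ℝ) ≤
              (Fintype.card F : ℝ) ^ (μ * (n - μ + 1)) * Nat.card (GL (Fin μ) F) := by
            exact_mod_cast card_rank_eq_le hμn
          exact h.trans (mul_le_mul_of_nonneg_right (rank_exponent_le hμn) (hG μ).le)
        calc ∑ A : Matrix (Fin μ) (Fin n) F with A.rank = μ, ∑ ℓ, f ℓ μ A i
            ≤ #{A : Matrix (Fin μ) (Fin n) F | A.rank = μ} • (Fintype.card β * δ) :=
              sum_le_card_nsmul _ _ _ fun A hA => hmean μ A (mem_filter.mp hA).2 i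
          _ ≤ Q * Nat.card (GL (Fin μ) F) * (Fintype.card β * δ) := by
              rw [nsmul_eq_mul]
              exact mul_le_mul_of_nonneg_right hcount (by positivity)
          _ = _ := by ring
    _ = _ := by
        simp only [sum_const, Nat.card_Icc, add_tsub_cancel_right, nsmul_eq_mul]
        ring

theorem one_sub_le_sum_ite {β : Type*} [Fintype β] [Nonempty β] {w : β → ℝ}
    (hw : ∀ ℓ, w ℓ = 1 / (Nat.card β : ℝ)) {E : β → Prop} [DecidablePred E] {ε : ℝ}
    (h : (#{ℓ | ¬ E ℓ} : ℝ) ≤ Fintype.card β * ε) :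
    1 - ε ≤ ∑ ℓ, if E ℓ then w ℓ else 0 := by
  have hβ : (0 : ℝ) < Fintype.card β := by exact_mod_cast Fintype.card_pos
  have hsplit : (#{ℓ | E ℓ} : ℝ) + #{ℓ | ¬ E ℓ} = Fintype.card β := by
    exact_mod_cast card_filter_add_card_filter_not (s := univ) E
  rw [← sum_filter, sum_congr rfl fun ℓ _ => hw ℓ, sum_const, nsmul_eq_mul, mul_one_div,
    Nat.card_eq_fintype_card, le_div_iff₀ hβ]
  linarith

end UnionBound

section Messages

variable {F : Type*} {T m n : ℕ} {k : Fin (T + 1) → ℕ}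

theorem concat2_injective (hk : ∑ i, k i = m * n) :
    Function.Injective (concat2 (F := F) k hk) := by
  intro s t hst
  have h (x : Σ i, Fin (k i)) : s x.1 x.2 = t x.1 x.2 := by
    have := congrFun hst (Fintype.equivOfCardEq
      (by simp [hk, Nat.mul_comm] :
        Fintype.card (Σ i : Fin (T + 1), Fin (k i)) = Fintype.card (Fin n × Fin m)) x)
    simp only [concat2] at this
    rwa [Equiv.symm_apply_apply] at this
  funext i j
  exact h ⟨i, j⟩

variable [Field F] [Fintype F] [DecidableEq F]

/-- The average over all encoders of the leakage through one eavesdropping matrix. -/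
theorem sum_mutInfo_le {𝒳 𝒵 : Type*} [Fintype 𝒳] (hk : ∑ i, k i = m * n)
    {p : (∀ i, Fin (k i) → F) → ℝ} (hp : ∀ s, 0 ≤ p s) (hp1 : ∑ s, p s = 1)
    (X : (∀ i, Fin (k i) → F) → 𝒳) (Z : (∀ i, Fin (k i) → F) → 𝒵)
    {μ : ℕ} {A : Matrix (Fin μ) (Fin n) F} (hA : A.rank = μ)
    {ρ : ℝ} (hρ0 : 0 < ρ) (hρ1 : ρ ≤ 1) :
    ∑ ℓ : GL (Fin n × Fin m) F, mutInfo p X (fun s =>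
        (Matrix.kroneckerMap (· * ·) A (1 : Matrix (Fin m) (Fin m) F)).mulVec
          ((ℓ : Matrix (Fin n × Fin m) (Fin n × Fin m) F).mulVec (concat2 k hk s))) ≤
      Fintype.card (GL (Fin n × Fin m) F) *
        ((Fintype.card F : ℝ) ^ ((m : ℝ) * ρ * (μ : ℝ)) * expPow p Z X ρ / ρ) := by
  have h := sum_mutInfo_le_of_twoUniversal hp hp1 X Z
    (fun (ℓ : GL (Fin n × Fin m) F) s =>
      (Matrix.kroneckerMap (· * ·) A (1 : Matrix (Fin m) (Fin m) F)).mulVec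
        ((ℓ : Matrix (Fin n × Fin m) (Fin n × Fin m) F).mulVec (concat2 k hk s)))
    (fun s t hst => ?_) hρ0 hρ1
  · rw [Fintype.card_fun, Nat.cast_pow, ← Real.rpow_natCast,
      ← Real.rpow_mul (Nat.cast_nonneg _)] at h
    rwa [Fintype.card_prod, Fintype.card_fin, Fintype.card_fin, Nat.cast_mul,
      show (μ * m * ρ : ℝ) = m * ρ * μ by ring] at h
  · have hne : concat2 k hk t - concat2 k hk s ≠ 0 :=
      sub_ne_zero.mpr fun h => hst (concat2_injective hk h).symm
    refine le_trans (le_of_eq ?_) (card_GL_mulVec_eq_zero_mul_le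
      (kronecker_one_mulVec_surjective (A := A) (κ' := Fin m) (by simpa using hA)) hne)
    simp only [Matrix.mulVec_sub, sub_eq_zero]
    congr!

end Messages


/-- With probability at least
`1 − 2(2^T − 1)·n·q^{(n+1)²/4}/C1` over the uniform choice of `L`, the
realization `ℓ` satisfies, simultaneously for every `1 ≤ μ ≤ n`, every
`(mμ) × (mn)` eavesdropping matrix `B = B_{μ×n} ⊗ I_m` with `rank B_{μ×n} = μ`,
and every nonempty `𝒾 ⊆ {1, …, T}`:
`I(S_𝒾 ; BLSᵗ | L = ℓ) ≤ C1·q^{mρμ}·E[P_{S_𝒾̄|S_𝒾}^ρ]/ρ`. -/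
theorem universal_good_realization_probability
    {F : Type*} [Field F] [Fintype F] [DecidableEq F]
    (m n T : ℕ) (hm : 0 < m) (hn : 0 < n) (hT : 0 < T)
    (k : Fin (T + 1) → ℕ) (hkpos : ∀ i, 0 < k i) (hk : ∑ i, k i = m * n)
    {Ω : Type*} [Fintype Ω] (p : Ω → ℝ) (hp0 : ∀ ω, 0 ≤ p ω) (hp1 : ∑ ω, p ω = 1)
    (S : Ω → (∀ i : Fin (T + 1), Fin (k i) → F))
    (L : Ω → GL (Fin n × Fin m) F)
    -- L is uniformly distributed
    (hLunif : ∀ ℓ, mprob p L ℓ = 1 / (Nat.card (GL (Fin n × Fin m) F) : ℝ))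
    -- L is statistically independent of S
    (hLS : ∀ s ℓ, jprob p S L s ℓ = mprob p S s * mprob p L ℓ)
    (ρ : ℝ) (hρ0 : 0 < ρ) (hρ1 : ρ ≤ 1) (C1 : ℝ) (hC1 : 1 < C1) :
    (∑ ℓ : GL (Fin n × Fin m) F,
        if (∀ μ : ℕ, 1 ≤ μ → μ ≤ n →
            ∀ B0 : Matrix (Fin μ) (Fin n) F, B0.rank = μ →
            ∀ 𝒾 : Finset (Fin (T + 1)), 𝒾.Nonempty → Fin.last T ∉ 𝒾 →
              mutInfo (condDist p L ℓ)
                (fun ω => fun i : 𝒾 => S ω i.1)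
                (fun ω => (Matrix.kroneckerMap (· * ·) B0
                    (1 : Matrix (Fin m) (Fin m) F)).mulVec
                  ((L ω : Matrix (Fin n × Fin m) (Fin n × Fin m) F).mulVec
                    (concat2 k hk (S ω))))
              ≤ C1 * (Fintype.card F : ℝ) ^ ((m : ℝ) * ρ * (μ : ℝ)) *
                  expPow p (fun ω => fun i : (𝒾ᶜ : Finset (Fin (T + 1))) => S ω i.1)
                    (fun ω => fun i : 𝒾 => S ω i.1) ρ / ρ)
        then mprob p L ℓ else 0)
      ≥ 1 - 2 * ((2 : ℝ) ^ T - 1) * (n : ℝ) *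
          (Fintype.card F : ℝ) ^ ((((n : ℝ) + 1) ^ 2) / 4) / C1 := by
  set P := mprob p S
  have hP0 : ∀ s, 0 ≤ P s := mprob_nonneg hp0 S
  have hP1 : ∑ s, P s = 1 := (sum_mprob p S).trans hp1
  have hq : (0 : ℝ) < Fintype.card F := by exact_mod_cast Fintype.card_pos
  have hLne (ℓ : GL (Fin n × Fin m) F) : mprob p L ℓ ≠ 0 := by
    rw [hLunif]
    exact one_div_ne_zero (by exact_mod_cast Nat.card_pos.ne')
  set X : ∀ I : Finset (Fin (T + 1)), (∀ i, Fin (k i) → F) → (∀ i : I, Fin (k i) → F) :=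
    fun I s i => s i.1
  set b : ℕ → Finset (Fin (T + 1)) → ℝ := fun μ I =>
    (Fintype.card F : ℝ) ^ ((m : ℝ) * ρ * (μ : ℝ)) * expPow P (X Iᶜ) (X I) ρ / ρ
  have hb (μ : ℕ) (I) : 0 < b μ I :=
    div_pos (mul_pos (Real.rpow_pos_of_pos hq _) (expPow_pos hP0 hP1 _ _ ρ)) hρ0
  set leak : GL (Fin n × Fin m) F → (μ : ℕ) → Matrix (Fin μ) (Fin n) F → Finset (Fin (T + 1)) → ℝ :=
    fun ℓ μ A I => mutInfo P (X I) fun s =>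
      (Matrix.kroneckerMap (· * ·) A (1 : Matrix (Fin m) (Fin m) F)).mulVec
        ((ℓ : Matrix (Fin n × Fin m) (Fin n × Fin m) F).mulVec (concat2 k hk s))
  have hleak (ℓ : GL (Fin n × Fin m) F) (μ : ℕ) (A : Matrix (Fin μ) (Fin n) F) (I : Finset (Fin (T + 1))) :
      mutInfo (condDist p L ℓ) (fun ω => fun i : I => S ω i.1)
        (fun ω => (Matrix.kroneckerMap (· * ·) A (1 : Matrix (Fin m) (Fin m) F)).mulVec
          ((L ω : Matrix (Fin n × Fin m) (Fin n × Fin m) F).mulVec (concat2 k hk (S ω)))) =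
        leak ℓ μ A I :=
    mutInfo_condDist (hLne ℓ) (fun s => hLS s ℓ) (X I) fun (ℓ : GL (Fin n × Fin m) F) s =>
      (Matrix.kroneckerMap (· * ·) A (1 : Matrix (Fin m) (Fin m) F)).mulVec
        ((ℓ : Matrix (Fin n × Fin m) (Fin n × Fin m) F).mulVec (concat2 k hk s))
  have hbound (μ : ℕ) (I : Finset (Fin (T + 1))) :
      C1 * (Fintype.card F : ℝ) ^ ((m : ℝ) * ρ * (μ : ℝ)) *
        expPow p (fun ω => fun i : (Iᶜ : Finset (Fin (T + 1))) => S ω i.1)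
          (fun ω => fun i : I => S ω i.1) ρ / ρ = C1 * b μ I := by
    have := expPow_map p S (X Iᶜ) (X I) ρ
    simp only [b, P, this]
    ring
  simp only [hleak, hbound]
  refine ge_iff_le.mpr (le_trans ?_ (one_sub_le_sum_ite hLunif
    (card_bad_le n ((univ.erase (Fin.last T)).powerset.erase ∅)
      (fun ℓ μ A I => leak ℓ μ A I / (C1 * b μ I))
      (fun ℓ μ A I => div_nonneg (mutInfo_nonneg hP0 hP1 _ _) (by have := hb μ I; positivity))
      (fun ℓ μ I g A => ?_) (δ := 1 / C1) (by positivity) (fun μ A hA I => ?_)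
      (fun ℓ hℓ => ?_))))
  · have hcard : (#((univ.erase (Fin.last T)).powerset.erase ∅) : ℝ) = 2 ^ T - 1 := by
      rw [card_erase_of_mem (by simp), card_powerset, card_erase_of_mem (mem_univ _)]
      simp [Nat.cast_sub Nat.one_le_two_pow]
    rw [hcard]
    set Q := (Fintype.card F : ℝ) ^ (((n : ℝ) + 1) ^ 2 / 4)
    have hnn : 0 ≤ n * ((2 : ℝ) ^ T - 1) * (Q * (1 / C1)) := by
      have : (0 : ℝ) ≤ 2 ^ T - 1 := sub_nonneg.mpr (one_le_pow₀ one_le_two)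
      positivity
    have htwo : 2 * ((2 : ℝ) ^ T - 1) * n * Q / C1 =
        2 * (n * ((2 : ℝ) ^ T - 1) * (Q * (1 / C1))) := by ring
    rw [htwo]
    linarith
  · have hinj : Function.Injective (Matrix.kroneckerMap (· * ·)
        (g : Matrix (Fin μ) (Fin μ) F) (1 : Matrix (Fin m) (Fin m) F)).mulVec := by
      refine Function.LeftInverse.injective (g := (Matrix.kroneckerMap (· * ·)
        ((g⁻¹ : GL (Fin μ) F) : Matrix (Fin μ) (Fin μ) F)
        (1 : Matrix (Fin m) (Fin m) F)).mulVec) fun x => ?_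
      rw [Matrix.mulVec_mulVec, ← Matrix.mul_kronecker_mul, ← Units.val_mul, inv_mul_cancel,
        mul_one, Units.val_one]
      exact (congrArg (·.mulVec x) Matrix.one_kronecker_one).trans (Matrix.one_mulVec x)
    have hmul : Matrix.kroneckerMap (· * ·) ((g : Matrix (Fin μ) (Fin μ) F) * A)
        (1 : Matrix (Fin m) (Fin m) F) =
        Matrix.kroneckerMap (· * ·) (g : Matrix (Fin μ) (Fin μ) F) (1 : Matrix (Fin m) (Fin m) F) *
          Matrix.kroneckerMap (· * ·) A (1 : Matrix (Fin m) (Fin m) F) := by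
      rw [← Matrix.mul_kronecker_mul, mul_one]
    simp only [leak, hmul, ← Matrix.mulVec_mulVec]
    rw [mutInfo_comp_injective P (X I) _ hinj]
  · have hC : 0 < C1 := by linarith
    rw [← sum_div, div_le_iff₀ (mul_pos hC (hb μ I))]
    refine (sum_mutInfo_le hk hP0 hP1 (X I) (X Iᶜ) hA hρ0 hρ1).trans_eq ?_
    change _ * b μ I = _
    field_simp
  · push Not at hℓ
    obtain ⟨μ, h1, hμ, A, hA, I, hI, hlast, hlt⟩ := hℓ
    refine ⟨μ, h1, hμ, A, hA, I, ?_, ?_⟩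
    · rw [mem_erase, mem_powerset]
      exact ⟨hI.ne_empty, fun i hi =>
        mem_erase.mpr ⟨fun h => hlast (h ▸ hi), mem_univ i⟩⟩
    · exact (one_le_div (mul_pos (by linarith) (hb μ I))).mpr hlt.le
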